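/- Let T, J be positive integers, f_{j,t} ∈ ℝ for j = 1..J, t = 1..T, and write f_j = (1, f_{j,1}, …, f_{j,T}) ∈ ℝ^{T+1}. Fix ρ ∈ (0, 1/2) and for θ ∈ ℝ^{T+1} set σ_j(θ) = σ(⟨f_j, θ⟩) with σ(z) = 1/(1+exp(−z)), and π_j(θ) = ρ + (1−2ρ)σ_j(θ). Consider the prior on (δ, γ) ∈ ({0,1})^T × ({0,1})^J given by p(δ, γ | θ) = 2^{−T} ∏_{j=1}^J π_j(θ)^{γ_j}(1−π_j(θ))^{1−γ_j}. Let L(δ,γ) > 0, H(θ) = Σ_{δ,γ} L(δ,γ) p(δ,γ | θ), posterior P(δ,γ | θ) = L(δ,γ)p(δ,γ|θ)/H(θ), and marginal posterior inclusion probability P_j(θ) = Σ_{(δ,γ): γ_j = 1} P(δ,γ | θ). Then ∇_θ log H(θ) = (1−2ρ) · Σ_{j=1}^J [σ_j(θ)(1−σ_j(θ)) / (π_j(θ)(1−π_j(θ)))] · (P_j(θ) − π_j(θ)) · f_j. -/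

import Mathlib

open scoped BigOperators

/-- The logistic (sigmoid) function `σ(z) = 1/(1+exp(−z))`. -/
noncomputable def sigmoid (z : ℝ) : ℝ := 1 / (1 + Real.exp (-z))

/-- The feature vector `f_j = (1, f_{j,1}, …, f_{j,T}) ∈ ℝ^{T+1}`. -/
noncomputable def cilFeat {T J : ℕ} (f : Fin J → Fin T → ℝ) (j : Fin J) :
    EuclideanSpace ℝ (Fin (T + 1)) := WithLp.toLp 2 (Fin.cons 1 (f j))

/-- The CIL prior inclusion probability `π_j(θ) = ρ + (1−2ρ)σ(⟨f_j, θ⟩)`. -/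
noncomputable def cilPi {T J : ℕ} (f : Fin J → Fin T → ℝ) (ρ : ℝ) (j : Fin J)
    (θ : EuclideanSpace ℝ (Fin (T + 1))) : ℝ :=
  ρ + (1 - 2 * ρ) * sigmoid (inner ℝ (cilFeat f j) θ)

/-- The model prior `p(δ, γ | θ) = 2^{−T} ∏_j π_j(θ)^{γ_j} (1−π_j(θ))^{1−γ_j}`. -/
noncomputable def cilPrior {T J : ℕ} (f : Fin J → Fin T → ℝ) (ρ : ℝ)
    (m : (Fin T → Bool) × (Fin J → Bool)) (θ : EuclideanSpace ℝ (Fin (T + 1))) : ℝ :=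
  (1 / 2 : ℝ) ^ T * ∏ j, (if m.2 j then cilPi f ρ j θ else 1 - cilPi f ρ j θ)

/-- The marginal likelihood `H(θ) = Σ_{δ,γ} L(δ,γ) p(δ,γ | θ)`. -/
noncomputable def cilMarglik {T J : ℕ} (f : Fin J → Fin T → ℝ) (ρ : ℝ)
    (L : (Fin T → Bool) × (Fin J → Bool) → ℝ)
    (θ : EuclideanSpace ℝ (Fin (T + 1))) : ℝ :=
  ∑ m : (Fin T → Bool) × (Fin J → Bool), L m * cilPrior f ρ m θ

/-- The marginal posterior inclusion probability
`P_j(θ) = Σ_{(δ,γ) : γ_j = 1} L(δ,γ) p(δ,γ|θ) / H(θ)`. -/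
noncomputable def cilPostIncl {T J : ℕ} (f : Fin J → Fin T → ℝ) (ρ : ℝ)
    (L : (Fin T → Bool) × (Fin J → Bool) → ℝ) (j : Fin J)
    (θ : EuclideanSpace ℝ (Fin (T + 1))) : ℝ :=
  ∑ m ∈ Finset.univ.filter (fun m : (Fin T → Bool) × (Fin J → Bool) => m.2 j),
    L m * cilPrior f ρ m θ / cilMarglik f ρ L θ

lemma cil_sig_pos (z : ℝ) : 0 < sigmoid z := by unfold sigmoid; positivity

lemma cil_sig_lt (z : ℝ) : sigmoid z < 1 := by
  unfold sigmoid
  have := Real.exp_pos (-z)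
  rw [div_lt_one (by positivity)]; linarith

lemma cil_sig_deriv (z : ℝ) : HasDerivAt sigmoid (sigmoid z * (1 - sigmoid z)) z := by
  have h0 := Real.exp_pos (-z)
  have hne : 1 + Real.exp (-z) ≠ 0 := by positivity
  have h1 : HasDerivAt (fun z : ℝ => 1 + Real.exp (-z)) (Real.exp (-z) * (-1)) z :=
    ((hasDerivAt_neg z).exp).const_add 1
  have h2 := h1.inv hne
  have h3 : sigmoid = (fun z : ℝ => 1 + Real.exp (-z))⁻¹ := by
    funext x; simp [sigmoid]
  rw [h3]
  refine h2.congr_deriv (Eq.symm ?_)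
  change (1 + Real.exp (-z))⁻¹ * (1 - (1 + Real.exp (-z))⁻¹) = _
  field_simp
  ring

lemma cil_pi_pos {T J : ℕ} (f : Fin J → Fin T → ℝ) (ρ : ℝ) (hρ : ρ ∈ Set.Ioo (0 : ℝ) (1 / 2))
    (j : Fin J) (θ : EuclideanSpace ℝ (Fin (T + 1))) :
    0 < cilPi f ρ j θ ∧ 0 < 1 - cilPi f ρ j θ := by
  obtain ⟨h1, h2⟩ := hρ
  have a := cil_sig_pos (inner ℝ (cilFeat f j) θ)
  have b := cil_sig_lt (inner ℝ (cilFeat f j) θ)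
  unfold cilPi
  constructor <;> nlinarith

lemma cil_pi_deriv {T J : ℕ} (f : Fin J → Fin T → ℝ) (ρ : ℝ)
    (j : Fin J) (θ : EuclideanSpace ℝ (Fin (T + 1))) :
    HasFDerivAt (cilPi f ρ j) (((1 - 2 * ρ) * (sigmoid (inner ℝ (cilFeat f j) θ) *
      (1 - sigmoid (inner ℝ (cilFeat f j) θ)))) • innerSL ℝ (cilFeat f j)) θ := by
  have h1 : HasFDerivAt (fun θ : EuclideanSpace ℝ (Fin (T + 1)) => inner ℝ (cilFeat f j) θ)
      (innerSL ℝ (cilFeat f j)) θ := (innerSL ℝ (cilFeat f j)).hasFDerivAt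
  have h2 := (((cil_sig_deriv _).comp_hasFDerivAt θ h1).const_mul (1 - 2 * ρ)).const_add ρ
  rw [smul_smul] at h2
  exact h2

lemma cil_prior_deriv {T J : ℕ} (f : Fin J → Fin T → ℝ) (ρ : ℝ)
    (hρ : ρ ∈ Set.Ioo (0 : ℝ) (1 / 2)) (m : (Fin T → Bool) × (Fin J → Bool))
    (θ : EuclideanSpace ℝ (Fin (T + 1))) :
    HasFDerivAt (cilPrior f ρ m) (∑ j, (cilPrior f ρ m θ *
      (((if m.2 j then 1 else 0) - cilPi f ρ j θ) * ((1 - 2 * ρ) *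
      (sigmoid (inner ℝ (cilFeat f j) θ) * (1 - sigmoid (inner ℝ (cilFeat f j) θ)) /
        (cilPi f ρ j θ * (1 - cilPi f ρ j θ)))))) • innerSL ℝ (cilFeat f j)) θ := by
  have hg : ∀ j ∈ (Finset.univ : Finset (Fin J)), HasFDerivAt
      (fun θ => if m.2 j then cilPi f ρ j θ else 1 - cilPi f ρ j θ)
      (((if m.2 j then 1 else -1) * ((1 - 2 * ρ) * (sigmoid (inner ℝ (cilFeat f j) θ) *
      (1 - sigmoid (inner ℝ (cilFeat f j) θ))))) • innerSL ℝ (cilFeat f j)) θ := by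
    intro j _
    have := cil_pi_deriv f ρ j θ
    cases m.2 j
    · simpa using this.const_sub 1
    · simpa using this
  have h := (HasFDerivAt.finsetProd hg).const_mul ((1 / 2 : ℝ) ^ T)
  refine h.congr_fderiv ?_
  rw [Finset.smul_sum]
  refine Finset.sum_congr rfl fun j _ => ?_
  rw [smul_smul, smul_smul]
  congr 1
  obtain ⟨p1, p2⟩ := cil_pi_pos f ρ hρ j θ
  unfold cilPrior
  rw [← Finset.mul_prod_erase Finset.univ _ (Finset.mem_univ j)]
  cases m.2 j
  · simp only [Bool.false_eq_true, if_false]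
    field_simp
    ring
  · simp only [if_true]
    field_simp

lemma cil_marg_pos {T J : ℕ} (f : Fin J → Fin T → ℝ) (ρ : ℝ)
    (hρ : ρ ∈ Set.Ioo (0 : ℝ) (1 / 2))
    (L : (Fin T → Bool) × (Fin J → Bool) → ℝ) (hL : ∀ m, 0 < L m)
    (θ : EuclideanSpace ℝ (Fin (T + 1))) : 0 < cilMarglik f ρ L θ := by
  unfold cilMarglik
  refine Finset.sum_pos (fun m _ => mul_pos (hL m) ?_) Finset.univ_nonempty
  unfold cilPrior
  refine mul_pos (by positivity) (Finset.prod_pos fun j _ => ?_)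
  obtain ⟨p1, p2⟩ := cil_pi_pos f ρ hρ j θ
  split_ifs <;> assumption

lemma cil_post {T J : ℕ} (f : Fin J → Fin T → ℝ) (ρ : ℝ)
    (L : (Fin T → Bool) × (Fin J → Bool) → ℝ) (j : Fin J)
    (θ : EuclideanSpace ℝ (Fin (T + 1))) (h : cilMarglik f ρ L θ ≠ 0) :
    cilPostIncl f ρ L j θ - cilPi f ρ j θ = (cilMarglik f ρ L θ)⁻¹ *
      ∑ m, L m * cilPrior f ρ m θ * ((if m.2 j then 1 else 0) - cilPi f ρ j θ) := by
  simp only [mul_sub, Finset.sum_sub_distrib, ← Finset.sum_mul]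
  change _ = _ - _ * (cilMarglik f ρ L θ * _)
  rw [inv_mul_cancel_left₀ h]
  unfold cilPostIncl
  rw [← Finset.sum_div, Finset.sum_filter, div_eq_inv_mul]
  simp only [mul_ite, mul_one, mul_zero]

/-- Corollary to Proposition 1, general `ρ ∈ (0,1/2)`, corrected form:
`∇_θ log H(θ) = (1−2ρ) Σ_j [σ_j(1−σ_j)/(π_j(1−π_j))] (P_j(θ) − π_j(θ)) f_j`. -/
theorem gradient_log_marglik_cil (T J : ℕ) (hT : 0 < T) (hJ : 0 < J)
    (f : Fin J → Fin T → ℝ) (ρ : ℝ) (hρ : ρ ∈ Set.Ioo (0 : ℝ) (1 / 2))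
    (L : (Fin T → Bool) × (Fin J → Bool) → ℝ) (hL : ∀ m, 0 < L m)
    (θ : EuclideanSpace ℝ (Fin (T + 1))) :
    gradient (fun θ' => Real.log (cilMarglik f ρ L θ')) θ =
      (1 - 2 * ρ) •
        ∑ j, ((sigmoid (inner ℝ (cilFeat f j) θ) * (1 - sigmoid (inner ℝ (cilFeat f j) θ)) /
                (cilPi f ρ j θ * (1 - cilPi f ρ j θ))) *
              (cilPostIncl f ρ L j θ - cilPi f ρ j θ)) • cilFeat f j := by
  have hH := cil_marg_pos f ρ hρ L hL θ
  have h1 : HasFDerivAt (cilMarglik f ρ L) _ θ :=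
    HasFDerivAt.fun_sum (u := Finset.univ)
      fun m _ => (cil_prior_deriv f ρ hρ m θ).const_mul (L m)
  have h2 := h1.log hH.ne'
  refine HasGradientAt.gradient ?_
  rw [hasGradientAt_iff_hasFDerivAt]
  refine h2.congr_fderiv ?_
  ext v
  simp only [ContinuousLinearMap.smul_apply, ContinuousLinearMap.sum_apply,
    InnerProductSpace.toDual_apply_apply, inner_smul_left, sum_inner, innerSL_apply_apply, smul_eq_mul,
    cil_post f ρ L _ θ hH.ne', Finset.mul_sum, Finset.sum_mul, conj_trivial]
  rw [Finset.sum_comm]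
  refine Finset.sum_congr rfl fun j _ => Finset.sum_congr rfl fun m _ => ?_
  ring
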